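/- arXiv:1912.02287 — 2 statements merged into one kernel-verified Lean document; each statement's English description precedes it below -/
import Mathlib

section
/- Let G be a group and n ≥ 3. If the tuple (σ_1, …, σ_{n-1}) belongs to the set A, then the tuple φ(σ_1, …, σ_{n-1}) = (σ_1, σ_1σ_2, …, σ_1σ_2⋯σ_{n-1}) belongs to the set B. -/
/-- The ordered product `σ r * σ (r+1) * ⋯ * σ s` (empty if `s < r`). -/
def partialProd {G : Type*} [Group G] (σ : ℕ → G) (r s : ℕ) : G :=
  ((List.Ico r (s + 1)).map σ).prod

/-- The tuple `α` with the convention `α_0 := 1`. -/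
def withOne {G : Type*} [Group G] (α : ℕ → G) : ℕ → G :=
  fun k => if k = 0 then 1 else α k

/-- `φ(σ_1,…,σ_{n-1}) := (σ_1, σ_1σ_2, …, σ_1σ_2⋯σ_{n-1})`, i.e. the `j`-th
component is `α_j := σ_1 ⋯ σ_j`. -/
def phiOf {G : Type*} [Group G] (σ : ℕ → G) : ℕ → G :=
  fun j => partialProd σ 1 j

/-- `ψ(α_1,…,α_{n-1}) := (α_1, α_1⁻¹α_2, …, α_{n-2}⁻¹α_{n-1})`, i.e. the `i`-th
component is `σ_i := α_{i-1}⁻¹ α_i` with the convention `α_0 := 1`. -/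
def psiOf {G : Type*} [Group G] (α : ℕ → G) : ℕ → G :=
  fun i => (withOne α (i - 1))⁻¹ * withOne α i

/-- `A_J`, the subgroup generated by
`{τ_{r,s} = σ_r ⋯ σ_s : 1 ≤ r ≤ s ≤ n-1, r-1 ∈ J, s ∈ J}`. -/
def AJOf {G : Type*} [Group G] (σ : ℕ → G) (n : ℕ) (J : Set ℕ) : Subgroup G :=
  Subgroup.closure
    {g : G | ∃ r s : ℕ, 1 ≤ r ∧ r ≤ s ∧ s ≤ n - 1 ∧ r - 1 ∈ J ∧ s ∈ J ∧ g = partialProd σ r s}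

/-- `G_J⁺`, the subgroup generated by `{α_i⁻¹ α_j : i, j ∈ J}` (with `α_0 := 1`). -/
def GJplusOf {G : Type*} [Group G] (α : ℕ → G) (J : Set ℕ) : Subgroup G :=
  Subgroup.closure {g : G | ∃ i ∈ J, ∃ j ∈ J, g = (withOne α i)⁻¹ * withOne α j}

/-- The set `A` of tuples `(σ_1,…,σ_{n-1})` such that: (i) the `σ_i` generate `G`;
(ii) every `σ_i` has order different from 1 and 2; (iii) `(σ_i ⋯ σ_j)² = 1` for all
`1 ≤ i < j ≤ n-1`; (iv) `A_I ∩ A_J = A_{I∩J}` for all `I, J ⊆ {0,…,n-1}`. -/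
def setA (G : Type*) [Group G] (n : ℕ) : Set (ℕ → G) :=
  {σ | Subgroup.closure {g : G | ∃ i, 1 ≤ i ∧ i ≤ n - 1 ∧ g = σ i} = ⊤
    ∧ (∀ i, 1 ≤ i → i ≤ n - 1 → orderOf (σ i) ≠ 1 ∧ orderOf (σ i) ≠ 2)
    ∧ (∀ i j, 1 ≤ i → i < j → j ≤ n - 1 → (partialProd σ i j) ^ 2 = 1)
    ∧ (∀ I J : Set ℕ, I ⊆ Set.Iic (n - 1) → J ⊆ Set.Iic (n - 1) →
        AJOf σ n I ⊓ AJOf σ n J = AJOf σ n (I ∩ J))}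

/-- The set `B` of tuples `(α_1,…,α_{n-1})` such that: (i) the `α_i` generate `G`;
(ii) for all `0 ≤ i, j ≤ n-1` (with `α_0 := 1`), `α_i⁻¹ α_j` has order exactly 2
whenever `|i-j| ≥ 2` and does not have order 2 whenever `|i-j| = 1`;
(iii) `G_J⁺ ∩ G_K⁺ = G_{J∩K}⁺` for all `J, K ⊆ {0,…,n-1}` with `|J|, |K| ≥ 2`. -/
def setB (G : Type*) [Group G] (n : ℕ) : Set (ℕ → G) :=
  {α | Subgroup.closure {g : G | ∃ i, 1 ≤ i ∧ i ≤ n - 1 ∧ g = α i} = ⊤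
    ∧ (∀ i j, i ≤ n - 1 → j ≤ n - 1 →
        (2 ≤ |(i : ℤ) - (j : ℤ)| → orderOf ((withOne α i)⁻¹ * withOne α j) = 2)
          ∧ (|(i : ℤ) - (j : ℤ)| = 1 → orderOf ((withOne α i)⁻¹ * withOne α j) ≠ 2))
    ∧ (∀ J K : Set ℕ, J ⊆ Set.Iic (n - 1) → K ⊆ Set.Iic (n - 1) →
        2 ≤ J.ncard → 2 ≤ K.ncard →
        GJplusOf α J ⊓ GJplusOf α K = GJplusOf α (J ∩ K))}

/-- `α_i⁻¹ α_j = σ_{i+1} ⋯ σ_j` for the tuple `α = φ(σ)`. -/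
theorem withOne_phiOf_inv_mul {G : Type*} [Group G] (σ : ℕ → G) {i j : ℕ} (hij : i ≤ j) :
    (withOne (phiOf σ) i)⁻¹ * withOne (phiOf σ) j = partialProd σ (i + 1) j := by
  have h : ∀ k, withOne (phiOf σ) k = partialProd σ 1 k := by
    intro k
    by_cases hk : k = 0
    · subst hk
      simp [withOne, partialProd]
    · simp [withOne, phiOf, hk]
  rw [h, h, inv_mul_eq_iff_eq_mul]
  unfold partialProd
  rw [← List.prod_append, ← List.map_append,
    List.Ico.append_consecutive (by omega) (by omega)]

theorem partialProd_self {G : Type*} [Group G] (σ : ℕ → G) (i : ℕ) :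
    partialProd σ i i = σ i := by
  simp [partialProd]

theorem AJOf_eq_GJplusOf_phiOf {G : Type*} [Group G] (σ : ℕ → G) (n : ℕ) {J : Set ℕ}
    (hJ : J ⊆ Set.Iic (n - 1)) : AJOf σ n J = GJplusOf (phiOf σ) J := by
  apply le_antisymm
  · refine (Subgroup.closure_le _).2 ?_
    rintro g ⟨r, s, hr, hrs, -, hrJ, hsJ, rfl⟩
    refine Subgroup.subset_closure ⟨r - 1, hrJ, s, hsJ, ?_⟩
    rw [withOne_phiOf_inv_mul σ (by omega), Nat.sub_add_cancel hr]
  · have key : ∀ i ∈ J, ∀ j ∈ J, i < j →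
        (withOne (phiOf σ) i)⁻¹ * withOne (phiOf σ) j ∈ AJOf σ n J := by
      intro i hi j hj hij
      exact Subgroup.subset_closure ⟨i + 1, j, by omega, by omega, hJ hj, hi, hj,
        withOne_phiOf_inv_mul σ hij.le⟩
    refine (Subgroup.closure_le _).2 ?_
    rintro g ⟨i, hi, j, hj, rfl⟩
    rcases lt_trichotomy i j with h | rfl | h
    · exact key i hi j hj h
    · simp
    · simpa using inv_mem (key j hj i hi h)

/-- The intersection property forces products of at least two consecutive entries to be
nontrivial. -/
theorem partialProd_ne_one_of_mem_setA {G : Type*} [Group G] {n : ℕ} {σ : ℕ → G}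
    (hσ : σ ∈ setA G n) {i j : ℕ} (hij : i + 2 ≤ j) (hj : j ≤ n - 1) :
    partialProd σ (i + 1) j ≠ 1 := by
  obtain ⟨-, hord, -, hint⟩ := hσ
  intro h
  have hsub₁ : ({i, i + 1} : Set ℕ) ⊆ Set.Iic (n - 1) := by
    rintro x (rfl | rfl) <;> simp only [Set.mem_Iic] <;> omega
  have hsub₂ : ({i + 1, j} : Set ℕ) ⊆ Set.Iic (n - 1) := by
    rintro x (rfl | rfl) <;> simp only [Set.mem_Iic] <;> omega
  have hinter : ({i, i + 1} ∩ {i + 1, j} : Set ℕ) = {i + 1} := by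
    ext x
    simp only [Set.mem_inter_iff, Set.mem_insert_iff, Set.mem_singleton_iff]
    omega
  have hI := hint _ _ hsub₁ hsub₂
  rw [hinter] at hI
  have h₁ : σ (i + 1) ∈ AJOf σ n {i, i + 1} :=
    Subgroup.subset_closure ⟨i + 1, i + 1, by omega, le_rfl, by omega, by simp, by simp,
      (partialProd_self σ _).symm⟩
  have h₂ : partialProd σ (i + 2) j ∈ AJOf σ n {i + 1, j} :=
    Subgroup.subset_closure ⟨i + 2, j, by omega, hij, hj, by simp, by simp, rfl⟩
  have hsplit : σ (i + 1) * partialProd σ (i + 2) j = 1 := by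
    rw [← h, ← partialProd_self σ (i + 1), ← withOne_phiOf_inv_mul σ (i := i) (by omega),
      ← withOne_phiOf_inv_mul σ (i := i + 1) (by omega),
      ← withOne_phiOf_inv_mul σ (i := i) (j := j) (by omega)]
    group
  rw [← eq_inv_iff_mul_eq_one] at hsplit
  have hmem : σ (i + 1) ∈ AJOf σ n {i + 1} := by
    rw [← hI]
    refine Subgroup.mem_inf.2 ⟨h₁, ?_⟩
    rw [hsplit]
    exact inv_mem h₂
  have hbot : AJOf σ n {i + 1} = ⊥ := by
    refine Subgroup.closure_eq_bot_iff.2 ?_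
    rintro g ⟨r, s, hr, hrs, -, hrJ, hsJ, -⟩
    simp only [Set.mem_singleton_iff] at hrJ hsJ
    omega
  rw [hbot, Subgroup.mem_bot] at hmem
  exact (hord (i + 1) (by omega) (by omega)).1 (by simp [hmem])

/-- If `(σ_1,…,σ_{n-1}) ∈ A` then `φ(σ_1,…,σ_{n-1}) = (σ_1, σ_1σ_2, …, σ_1⋯σ_{n-1}) ∈ B`. -/
theorem phi_mem_setB {G : Type*} [Group G] (n : ℕ) (hn : 3 ≤ n)
    (σ : ℕ → G) (hσ : σ ∈ setA G n) :
    phiOf σ ∈ setB G n := by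
  have hA := hσ
  obtain ⟨hgen, hord, hsq, hint⟩ := hσ
  refine ⟨?_, ?_, ?_⟩
  · rw [eq_top_iff, ← hgen, Subgroup.closure_le]
    rintro g ⟨i, hi, hin, rfl⟩
    have hmem : ∀ k ≤ n - 1, withOne (phiOf σ) k ∈
        Subgroup.closure {g : G | ∃ i, 1 ≤ i ∧ i ≤ n - 1 ∧ g = phiOf σ i} := by
      intro k hk
      by_cases hk0 : k = 0
      · simp [withOne, hk0]
      · exact Subgroup.subset_closure ⟨k, by omega, hk, by simp [withOne, hk0]⟩
    have h := withOne_phiOf_inv_mul σ (i := i - 1) (j := i) (by omega)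
    rw [Nat.sub_add_cancel hi, partialProd_self] at h
    rw [← h]
    exact mul_mem (inv_mem (hmem _ (by omega))) (hmem _ hin)
  · have key : ∀ i j, i < j → j ≤ n - 1 →
        (i + 2 ≤ j → orderOf ((withOne (phiOf σ) i)⁻¹ * withOne (phiOf σ) j) = 2) ∧
        (i + 1 = j → orderOf ((withOne (phiOf σ) i)⁻¹ * withOne (phiOf σ) j) ≠ 2) := by
      intro i j hij hj
      rw [withOne_phiOf_inv_mul σ hij.le]
      refine ⟨fun h => ?_, fun h => ?_⟩
      · exact orderOf_eq_prime (hsq _ _ (by omega) (by omega) hj)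
          (partialProd_ne_one_of_mem_setA hA h hj)
      · rw [h, partialProd_self]
        exact (hord j (by omega) hj).2
    intro i j hi hj
    rcases lt_trichotomy i j with h | rfl | h
    · exact ⟨fun hd => (key i j h hj).1 (by grind), fun hd => (key i j h hj).2 (by grind)⟩
    · simp
    · rw [← orderOf_inv ((withOne (phiOf σ) i)⁻¹ * withOne (phiOf σ) j), mul_inv_rev, inv_inv]
      exact ⟨fun hd => (key j i h hi).1 (by grind), fun hd => (key j i h hi).2 (by grind)⟩
  · intro J K hJ hK _ _
    rw [← AJOf_eq_GJplusOf_phiOf σ n hJ, ← AJOf_eq_GJplusOf_phiOf σ n hK,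
      ← AJOf_eq_GJplusOf_phiOf σ n (Set.inter_subset_left.trans hJ)]
    exact hint J K hJ hK
end

section
/- Let G be a group and n ≥ 3. If the tuple (α_1, …, α_{n-1}) belongs to the set B, then the tuple ψ(α_1, …, α_{n-1}) = (α_1, α_1^{-1}α_2, α_2^{-1}α_3, …, α_{n-2}^{-1}α_{n-1}) belongs to the set A. -/
theorem partialProd_psiOf {G : Type*} [Group G] (α : ℕ → G) (r : ℕ) {s : ℕ} (hrs : r ≤ s) :
    partialProd (psiOf α) (r + 1) s = (withOne α r)⁻¹ * withOne α s := by
  induction s, hrs using Nat.le_induction with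
  | base => simp [partialProd]
  | succ s hs ih =>
    unfold partialProd at ih ⊢
    rw [List.Ico.succ_top (by omega), List.map_append, List.prod_append, ih]
    simp [psiOf]

theorem AJOf_psiOf {G : Type*} [Group G] (α : ℕ → G) (n : ℕ) {J : Set ℕ}
    (hJ : J ⊆ Set.Iic (n - 1)) : AJOf (psiOf α) n J = GJplusOf α J := by
  apply le_antisymm
  · refine (Subgroup.closure_le _).2 ?_
    rintro g ⟨r, s, hr, hrs, -, hrJ, hsJ, rfl⟩
    obtain ⟨r, rfl⟩ := Nat.exists_eq_add_of_le' hr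
    rw [partialProd_psiOf α r (by omega)]
    exact Subgroup.subset_closure ⟨r, hrJ, s, hsJ, rfl⟩
  · have mem_of_lt : ∀ i ∈ J, ∀ j ∈ J, i < j →
        (withOne α i)⁻¹ * withOne α j ∈ AJOf (psiOf α) n J := fun i hi j hj hij =>
      Subgroup.subset_closure ⟨i + 1, j, by omega, hij, hJ hj, hi, hj,
        (partialProd_psiOf α i hij.le).symm⟩
    refine (Subgroup.closure_le _).2 ?_
    rintro g ⟨i, hi, j, hj, rfl⟩
    rcases lt_trichotomy i j with h | rfl | h
    · exact mem_of_lt i hi j hj h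
    · simp
    · simpa using inv_mem (mem_of_lt j hj i hi h)

theorem GJplusOf_eq_bot {G : Type*} [Group G] (α : ℕ → G) {J : Set ℕ}
    (hJ : J.Subsingleton) : GJplusOf α J = ⊥ := by
  refine Subgroup.closure_eq_bot_iff.2 ?_
  rintro g ⟨i, hi, j, hj, rfl⟩
  simp [hJ hi hj]

theorem closure_le_closure_psiOf {G : Type*} [Group G] (α : ℕ → G) (m : ℕ) :
    Subgroup.closure {g : G | ∃ i, 1 ≤ i ∧ i ≤ m ∧ g = α i} ≤
      Subgroup.closure {g : G | ∃ i, 1 ≤ i ∧ i ≤ m ∧ g = psiOf α i} := by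
  have key : ∀ i ≤ m, withOne α i ∈
      Subgroup.closure {g : G | ∃ i, 1 ≤ i ∧ i ≤ m ∧ g = psiOf α i} := by
    intro i
    induction i with
    | zero => intro _; simp [withOne]
    | succ i ih =>
      intro hi
      have := mul_mem (ih (by omega)) (Subgroup.subset_closure ⟨i + 1, by omega, hi, rfl⟩)
      simpa [psiOf] using this
  refine (Subgroup.closure_le _).2 ?_
  rintro g ⟨i, hi, him, rfl⟩
  simpa [withOne, show i ≠ 0 by omega] using key i him

/-- If `(α_1,…,α_{n-1}) ∈ B` then `ψ(α_1,…,α_{n-1}) = (α_1, α_1⁻¹α_2, …, α_{n-2}⁻¹α_{n-1}) ∈ A`. -/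
theorem psi_mem_setA {G : Type*} [Group G] (n : ℕ) (hn : 3 ≤ n)
    (α : ℕ → G) (hα : α ∈ setB G n) :
    psiOf α ∈ setA G n := by
  obtain ⟨hgen, hord, hint⟩ := hα
  refine ⟨?_, ?_, ?_, ?_⟩
  · exact top_le_iff.1 (hgen ▸ closure_le_closure_psiOf α (n - 1))
  · intro i hi hin
    obtain ⟨i, rfl⟩ := Nat.exists_eq_add_of_le' hi
    refine ⟨fun h => ?_, (hord i (i + 1) (by omega) hin).2 (by simp)⟩
    rw [orderOf_eq_one_iff] at h
    have heq : withOne α i = withOne α (i + 1) := inv_mul_eq_one.1 h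
    rcases i with _ | i
    · refine (hord 1 2 (by omega) (by omega)).2 (by norm_num) ?_
      rw [← heq]
      exact (hord 0 2 (by omega) (by omega)).1 (by norm_num)
    · refine (hord i (i + 1) (by omega) (by omega)).2 (by simp) ?_
      rw [heq]
      exact (hord i (i + 1 + 1) (by omega) hin).1
        (by rw [abs_sub_comm]; exact le_abs.2 (Or.inl (by push_cast; omega)))
  · intro i j hi hij hj
    obtain ⟨i, rfl⟩ := Nat.exists_eq_add_of_le' hi
    rw [partialProd_psiOf α i (by omega)]
    exact orderOf_dvd_iff_pow_eq_one.1 ((hord i j (by omega) hj).1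
      (by rw [abs_sub_comm]; exact le_abs.2 (Or.inl (by omega)))).dvd
  · intro I J hI hJ
    rw [AJOf_psiOf α n hI, AJOf_psiOf α n hJ, AJOf_psiOf α n (Set.inter_subset_left.trans hI)]
    have subsingleton_of_ncard : ∀ K ⊆ Set.Iic (n - 1), ¬ 2 ≤ K.ncard → K.Subsingleton :=
      fun K hK h a ha b hb => (Set.ncard_le_one
        ((Set.finite_Iic _).subset hK)).1 (by omega) a ha b hb
    by_cases hI2 : 2 ≤ I.ncard
    · by_cases hJ2 : 2 ≤ J.ncard
      · exact hint I J hI hJ hI2 hJ2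
      · have hs := subsingleton_of_ncard J hJ hJ2
        rw [GJplusOf_eq_bot α hs, GJplusOf_eq_bot α (hs.anti Set.inter_subset_right), inf_bot_eq]
    · have hs := subsingleton_of_ncard I hI hI2
      rw [GJplusOf_eq_bot α hs, GJplusOf_eq_bot α (hs.anti Set.inter_subset_left), bot_inf_eq]
end
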